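/- (Applegate–Lagarias) There are infinitely many positive integers n that take at least 6.143·log n steps to reach 1 under iteration of the 3x+1 function: the set of positive integers n such that T^[k](n) = 1 implies k ≥ 6.143·log n (natural logarithm) is infinite. -/

import Mathlib

/-- The 3x+1 function on the natural numbers. -/
def T (n : ℕ) : ℕ := if n % 2 = 1 then (3 * n + 1) / 2 else n / 2


open Finset

/-- Number of odd iterates among the first `t`. -/
def oddCount (t n : ℕ) : ℕ := ∑ s ∈ Finset.range t, (T^[s] n) % 2

lemma oddCount_succ (t n : ℕ) : oddCount (t+1) n = oddCount t n + (T^[t] n) % 2 := by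
  simp [oddCount, Finset.sum_range_succ]

lemma oddCount_succ' (t n : ℕ) : oddCount (t+1) n = oddCount t (T n) + n % 2 := by
  simp [oddCount, Finset.sum_range_succ', Function.iterate_succ_apply]

lemma oddCount_le (t n : ℕ) : oddCount t n ≤ t := by
  induction t with
  | zero => simp [oddCount]
  | succ t ih => rw [oddCount_succ]; omega

lemma T_even (q : ℕ) : T (2*q) = q := by
  unfold T; rw [if_neg (by omega)]; omega

lemma T_odd (q : ℕ) : T (2*q+1) = 3*q+2 := by
  unfold T; rw [if_pos (by omega)]; omega

lemma oddCount_periodic (t : ℕ) : ∀ j n c : ℕ, t ≤ j →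
    oddCount t (n + 2^j * c) = oddCount t n := by
  induction t with
  | zero => intros; simp [oddCount]
  | succ t ih =>
    intro j n c h
    obtain ⟨j, rfl⟩ : ∃ i, j = i + 1 := ⟨j-1, by omega⟩
    rw [oddCount_succ', oddCount_succ']
    obtain ⟨q, rfl | rfl⟩ : ∃ q, n = 2*q ∨ n = 2*q+1 := ⟨n/2, by omega⟩
    · have h1 : 2*q + 2^(j+1)*c = 2*(q + 2^j*c) := by ring
      rw [h1, T_even, T_even, ih j q c (by omega)]; omega
    · have h1 : 2*q + 1 + 2^(j+1)*c = 2*(q + 2^j*c) + 1 := by ring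
      have h2 : 3*(q+2^j*c)+2 = (3*q+2) + 2^j*(3*c) := by ring
      rw [h1, T_odd, T_odd, h2, ih j _ _ (by omega)]; omega

lemma sum_range_two_mul (f : ℕ → ℝ) (N : ℕ) :
    ∑ n ∈ range (2*N), f n = ∑ q ∈ range N, f (2*q) + ∑ q ∈ range N, f (2*q+1) := by
  induction N with
  | zero => simp
  | succ N ih =>
    rw [show 2*(N+1) = 2*N+1+1 by ring, sum_range_succ, sum_range_succ, ih, sum_range_succ,
      sum_range_succ]; ring

lemma sum_perm (j : ℕ) (f : ℕ → ℝ) (hf : ∀ n c, f (n + 2^j*c) = f n) :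
    ∑ q ∈ range (2^j), f (3*q+2) = ∑ q ∈ range (2^j), f q := by
  have hmod : ∀ n, f (n % 2^j) = f n := by
    intro n
    conv_rhs => rw [← Nat.mod_add_div n (2^j)]
    rw [hf]
  have hpos : 0 < 2^j := by positivity
  have hinj : Set.InjOn (fun q => (3*q+2) % 2^j) (range (2^j) : Finset ℕ) := by
    intro a ha b hb hab
    simp only [coe_range, Set.mem_Iio] at ha hb
    have h1 : 3*a+2 ≡ 3*b+2 [MOD 2^j] := hab
    have h2 : 3*a ≡ 3*b [MOD 2^j] := Nat.ModEq.add_right_cancel' 2 h1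
    have h3 : a ≡ b [MOD 2^j] := by
      refine Nat.ModEq.cancel_left_of_coprime ?_ h2
      exact Nat.Coprime.pow_left j (by norm_num)
    exact Nat.ModEq.eq_of_lt_of_lt h3 ha hb
  have himg : (range (2^j)).image (fun q => (3*q+2) % 2^j) = range (2^j) := by
    apply Finset.eq_of_subset_of_card_le
    · intro x hx
      simp only [mem_image, mem_range] at hx ⊢
      obtain ⟨a, _, rfl⟩ := hx
      exact Nat.mod_lt _ hpos
    · rw [Finset.card_image_of_injOn hinj]
  conv_rhs => rw [← himg]
  rw [Finset.sum_image hinj]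
  exact Finset.sum_congr rfl (fun q _ => (hmod _).symm)

lemma gen_fun (z : ℝ) (t : ℕ) : ∀ j, t ≤ j →
    ∑ n ∈ range (2^j), z^(oddCount t n) = 2^(j-t) * (1+z)^t := by
  induction t with
  | zero => intro j _; simp [oddCount]
  | succ t ih =>
    intro j h
    obtain ⟨j, rfl⟩ : ∃ i, j = i + 1 := ⟨j-1, by omega⟩
    have ht : t ≤ j := by omega
    rw [show 2^(j+1) = 2*2^j by ring, sum_range_two_mul]
    have h1 : ∀ q, oddCount (t+1) (2*q) = oddCount t q := by
      intro q; rw [oddCount_succ', T_even]; omega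
    have h2 : ∀ q, oddCount (t+1) (2*q+1) = oddCount t (3*q+2) + 1 := by
      intro q; rw [oddCount_succ', T_odd]; omega
    simp only [h1, h2, pow_succ, ← Finset.sum_mul]
    rw [sum_perm j (fun q => z^(oddCount t q)) (fun n c => by simp only [oddCount_periodic t j n c ht]),
      ih j ht, Nat.add_sub_add_right]
    ring

/-- Chernoff bound. -/
lemma chernoff (j t : ℕ) (ht : t ≤ j) (l d : ℝ) (S : Finset ℕ) (hS : S ⊆ range (2^j))
    (h : ∀ n ∈ S, 0 ≤ l * ((t:ℝ)/2 - oddCount t n) - d) :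
    (S.card : ℝ) ≤ 2^j * Real.exp (l^2 * j / 8 - d) := by
  have h1 : (S.card : ℝ) ≤ ∑ n ∈ S, Real.exp (l * ((t:ℝ)/2 - oddCount t n) - d) := by
    have : (S.card : ℝ) = ∑ n ∈ S, (1:ℝ) := by simp
    rw [this]
    exact Finset.sum_le_sum fun n hn => Real.one_le_exp (h n hn)
  have h2 : ∑ n ∈ S, Real.exp (l * ((t:ℝ)/2 - oddCount t n) - d)
      ≤ ∑ n ∈ range (2^j), Real.exp (l * ((t:ℝ)/2 - oddCount t n) - d) :=
    Finset.sum_le_sum_of_subset_of_nonneg hS (fun _ _ _ => (Real.exp_pos _).le)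
  have h3 : ∀ n, Real.exp (l * ((t:ℝ)/2 - oddCount t n) - d)
      = Real.exp (l*t/2 - d) * (Real.exp (-l))^(oddCount t n) := by
    intro n
    rw [← Real.exp_nat_mul, ← Real.exp_add]; congr 1; ring
  have h4 : Real.exp (l*t/2 - d) * (2^(j-t) * (1+Real.exp (-l))^t)
      = 2^j * (Real.cosh (l/2))^t * Real.exp (-d) := by
    have e1 : Real.exp (l*t/2 - d) = (Real.exp (l/2))^t * Real.exp (-d) := by
      rw [← Real.exp_nat_mul, ← Real.exp_add]; congr 1; ring
    have e2 : Real.exp (l/2) * (1+Real.exp (-l)) = 2 * Real.cosh (l/2) := by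
      rw [Real.cosh_eq, mul_add, ← Real.exp_add, show l/2 + -l = -(l/2) by ring]; ring
    have e3 : (2:ℝ)^j = 2^(j-t) * 2^t := by rw [← pow_add]; congr 1; omega
    calc _ = 2^(j-t) * (Real.exp (l/2) * (1+Real.exp (-l)))^t * Real.exp (-d) := by
            rw [e1, mul_pow]; ring
      _ = _ := by rw [e2, mul_pow, e3]; ring
  have h5 : (Real.cosh (l/2))^t ≤ Real.exp (l^2*j/8) := by
    calc (Real.cosh (l/2))^t ≤ (Real.exp ((l/2)^2/2))^t :=
          pow_le_pow_left₀ (Real.cosh_pos _).le (Real.cosh_le_exp_half_sq _) t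
      _ = Real.exp (l^2*t/8) := by rw [← Real.exp_nat_mul]; congr 1; ring
      _ ≤ _ := by
        apply Real.exp_le_exp.2
        have : (t:ℝ) ≤ j := by exact_mod_cast ht
        have := mul_le_mul_of_nonneg_left this (sq_nonneg l)
        linarith
  calc (S.card : ℝ) ≤ ∑ n ∈ range (2^j), Real.exp (l * ((t:ℝ)/2 - oddCount t n) - d) := h1.trans h2
    _ = 2^j * (Real.cosh (l/2))^t * Real.exp (-d) := by
      simp only [h3, ← Finset.mul_sum]
      rw [gen_fun _ t j ht, h4]
    _ ≤ 2^j * Real.exp (l^2*j/8) * Real.exp (-d) := by gcongr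
    _ = _ := by rw [mul_assoc, ← Real.exp_add]; congr 2

/-- Affine formula for iterates. -/
lemma affine (n : ℕ) (b : ℝ) (hb : 0 ≤ b) (t : ℕ) (h : ∀ s < t, (2:ℝ)^s ≤ b * 3^(oddCount s n)) :
    ∃ r : ℝ, 0 ≤ r ∧ r ≤ t * b ∧ (2:ℝ)^t * (T^[t] n : ℕ) = 3^(oddCount t n) * (n + r) := by
  induction t with
  | zero => exact ⟨0, le_rfl, by simp, by simp [oddCount]⟩
  | succ t ih =>
    obtain ⟨r, h0, h1, h2⟩ := ih (fun s hs => h s (by omega))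
    have hq := h t (by omega)
    rw [oddCount_succ, Function.iterate_succ_apply']
    obtain ⟨q, hq' | hq'⟩ : ∃ q, T^[t] n = 2*q ∨ T^[t] n = 2*q+1 := ⟨T^[t] n/2, by omega⟩
    · refine ⟨r, h0, by push_cast; linarith, ?_⟩
      rw [hq'] at h2 ⊢
      rw [T_even, show 2*q%2 = 0 by omega, add_zero, ← h2]; push_cast; ring
    · refine ⟨r + 2^t / (3 * 3^(oddCount t n)), by positivity, ?_, ?_⟩
      · have : (2:ℝ)^t / (3 * 3^(oddCount t n)) ≤ b := by
          rw [div_le_iff₀ (by positivity)]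
          have : 0 ≤ b * 3^(oddCount t n) := by positivity
          linarith
        push_cast; linarith
      · rw [hq'] at h2 ⊢
        rw [T_odd, show (2*q+1)%2 = 1 by omega]
        push_cast at h2 ⊢
        have h3 : (3:ℝ)^(oddCount t n) ≠ 0 := by positivity
        calc (2:ℝ)^(t+1) * (3*q+2) = 3 * (2^t*(2*q+1)) + 2^t := by ring
          _ = _ := by rw [h2]; field_simp; ring

lemma card_window (S : Finset ℕ) (Q : ℝ) (h : ∀ a ∈ S, ∀ b ∈ S, (a:ℝ) ≤ b + Q) :
    S.card ≤ ⌊Q⌋₊ + 1 := by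
  rcases S.eq_empty_or_nonempty with rfl | hne
  · simp
  · have hsub : S ⊆ Finset.Icc (S.min' hne) (S.min' hne + ⌊Q⌋₊) := by
      intro a ha
      rw [Finset.mem_Icc]
      refine ⟨S.min'_le a ha, ?_⟩
      have h1 := h a ha _ (S.min'_mem hne)
      have h2 : a - S.min' hne ≤ ⌊Q⌋₊ := by
        apply Nat.le_floor
        rw [Nat.cast_sub (S.min'_le a ha)]; linarith
      omega
    have := Finset.card_le_card hsub
    simp only [Nat.card_Icc] at this
    omega

lemma iterate_one (k : ℕ) : T^[k] 1 = 1 ∨ T^[k] 1 = 2 := by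
  induction k with
  | zero => simp
  | succ k ih =>
    rw [Function.iterate_succ_apply']
    rcases ih with h | h <;> rw [h] <;> simp [T]

lemma le_two_pow (k : ℕ) : ∀ n, T^[k] n = 1 → n ≤ 2^k := by
  induction k with
  | zero => intro n h; simp at h; simp [h]
  | succ k ih =>
    intro n h
    rw [Function.iterate_succ_apply] at h
    have := ih _ h
    have h2 : n ≤ 2 * T n := by unfold T; split_ifs <;> omega
    rw [pow_succ]; omega

open Classical in
/-- Integers up to `X` reaching 1 in fewer than `g * log X` steps. -/
noncomputable def fastSet (g X : ℝ) : Finset ℕ :=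
  (Finset.range (⌊X⌋₊ + 1)).filter (fun m => ∃ k : ℕ, (k:ℝ) < g * Real.log X ∧ T^[k] m = 1)

lemma mem_fastSet {g X : ℝ} (hX : 0 ≤ X) {m : ℕ} :
    m ∈ fastSet g X ↔ (m:ℝ) ≤ X ∧ ∃ k : ℕ, (k:ℝ) < g * Real.log X ∧ T^[k] m = 1 := by
  classical
  simp only [fastSet, Finset.mem_filter, Finset.mem_range, Nat.lt_succ_iff, Nat.le_floor_iff hX]

lemma typical_pow (j s : ℕ) (hs : s ≤ j) (e : ℝ) (p : ℕ) (h : (s:ℝ)/2 - e ≤ p) :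
    (2:ℝ)^s ≤ (2^j * (3:ℝ)^(e - (j:ℝ)/2)) * 3^p := by
  have h1 : (3:ℝ)^((s:ℝ)/2 - e) ≤ 3^p := by
    rw [← Real.rpow_natCast]
    exact Real.rpow_le_rpow_of_exponent_le (by norm_num) h
  have h2 : (3:ℝ)^(((j-s:ℕ):ℝ)/2) ≤ 2^(j-s) := by
    rw [div_eq_mul_inv, mul_comm, Real.rpow_mul (by norm_num), Real.rpow_natCast]
    apply pow_le_pow_left₀ (by positivity)
    have : ((3:ℝ)^(2:ℝ)⁻¹) ≤ (4:ℝ)^(2:ℝ)⁻¹ := Real.rpow_le_rpow (by norm_num) (by norm_num) (by norm_num)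
    have h4 : (4:ℝ)^(2:ℝ)⁻¹ = 2 := by
      rw [show (4:ℝ) = 2^(2:ℝ) by norm_num, ← Real.rpow_mul (by norm_num)]; norm_num
    linarith
  have h3 : (2:ℝ)^j = 2^s * 2^(j-s) := by rw [← pow_add]; congr 1; omega
  have h5 : (3:ℝ)^(((j-s:ℕ):ℝ)/2) * (3:ℝ)^(e - (j:ℝ)/2) * (3:ℝ)^((s:ℝ)/2 - e) = 1 := by
    rw [← Real.rpow_add (by norm_num), ← Real.rpow_add (by norm_num), Nat.cast_sub hs]
    ring_nf; simp
  calc (2:ℝ)^s = 2^s * ((3:ℝ)^(((j-s:ℕ):ℝ)/2) * (3:ℝ)^(e - (j:ℝ)/2) * (3:ℝ)^((s:ℝ)/2 - e)) := by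
        rw [h5, mul_one]
    _ ≤ 2^s * (2^(j-s) * (3:ℝ)^(e - (j:ℝ)/2) * 3^p) := by gcongr
    _ = _ := by rw [h3]; ring

lemma count_step (g g2 : ℝ) (hg : 1 ≤ g) (hg2 : g2 * Real.log 2 ≤ 1 + g * (Real.log 3 / 2))
    (j : ℕ) (hj : 1 ≤ j) (η : ℝ) (h0 : 0 < η) (h1 : η ≤ 1/2) (S : Finset ℕ)
    (hS : ∀ n ∈ S, n < 2^j ∧ ∃ k : ℕ, (k:ℝ) < g2 * (j * Real.log 2) ∧ T^[k] n = 1) :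
    (S.card : ℝ) ≤ (j+2) * (2^j * Real.exp (-(2*η^2*j))) +
      (j * (2^j * (3:ℝ)^(η*j - (j:ℝ)/2)) + 1) * ((j+1) *
        (fastSet g ((j+1) * (3:ℝ)^((j:ℝ)/2 + η*j))).card) := by
  classical
  set M : ℝ := (j+1) * (3:ℝ)^((j:ℝ)/2 + η*j) with hM
  set b : ℝ := 2^j * (3:ℝ)^(η*j - (j:ℝ)/2) with hb
  have hbpos : 0 ≤ b := by positivity
  have hj' : (1:ℝ) ≤ j := by exact_mod_cast hj
  have hM0 : 0 ≤ M := by positivity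
  set Lo : ℕ → Finset ℕ := fun t => (range (2^j)).filter
    (fun n => (oddCount t n : ℝ) < (t:ℝ)/2 - η*j) with hLo
  set Hi : Finset ℕ := (range (2^j)).filter (fun n => (j:ℝ)/2 + η*j < (oddCount j n : ℝ)) with hHi
  set G : Finset ℕ := S.filter (fun n => (∀ t ≤ j, (t:ℝ)/2 - η*j ≤ (oddCount t n : ℝ)) ∧
    (oddCount j n : ℝ) ≤ (j:ℝ)/2 + η*j) with hG
  have hcover : S ⊆ ((range (j+1)).biUnion Lo ∪ Hi) ∪ G := by
    intro n hn
    have hlt := (hS n hn).1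
    by_contra hcon
    simp only [Finset.mem_union, not_or, Finset.mem_biUnion, not_exists, not_and, hLo, hHi, hG,
      Finset.mem_filter, Finset.mem_range, not_lt] at hcon
    obtain ⟨⟨c1, c2⟩, c3⟩ := hcon
    exact absurd (c2 hlt) (not_le.2 (by
      exact not_le.1 (c3 hn (fun t ht => c1 t (by omega) hlt))))
  have hLoc : ∀ t ∈ range (j+1), ((Lo t).card : ℝ) ≤ 2^j * Real.exp (-(2*η^2*j)) := by
    intro t ht
    have := chernoff j t (by simp at ht; omega) (4*η) (4*η^2*j) (Lo t) (Finset.filter_subset _ _) (by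
      intro n hn
      simp only [hLo, Finset.mem_filter] at hn
      nlinarith [hn.2])
    refine this.trans (le_of_eq ?_)
    congr 2; ring
  have hHic : (Hi.card : ℝ) ≤ 2^j * Real.exp (-(2*η^2*j)) := by
    have := chernoff j j le_rfl (-(4*η)) (4*η^2*j) Hi (Finset.filter_subset _ _) (by
      intro n hn
      simp only [hHi, Finset.mem_filter] at hn
      nlinarith [hn.2])
    refine this.trans (le_of_eq ?_)
    congr 2; ring
  have haff : ∀ n ∈ G, ∃ r : ℝ, 0 ≤ r ∧ r ≤ j * b ∧
      (2:ℝ)^j * (T^[j] n : ℕ) = 3^(oddCount j n) * (n + r) := by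
    intro n hn
    simp only [hG, Finset.mem_filter] at hn
    exact affine n b hbpos j (fun s hs => typical_pow j s hs.le (η*j) _ (hn.2.1 s hs.le))
  have hlogM : (j:ℝ) * (Real.log 3 / 2) ≤ Real.log M := by
    have e1 : (3:ℝ)^((j:ℝ)/2) ≤ M := by
      have : (3:ℝ)^((j:ℝ)/2) ≤ (3:ℝ)^((j:ℝ)/2 + η*j) :=
        Real.rpow_le_rpow_of_exponent_le (by norm_num) (by nlinarith)
      have h3 : (0:ℝ) < (3:ℝ)^((j:ℝ)/2 + η*j) := by positivity
      nlinarith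
    have := Real.log_le_log (by positivity) e1
    rw [Real.log_rpow (by norm_num)] at this
    linarith
  have hlogM1 : 1 < Real.log M := by
    rw [Real.lt_log_iff_exp_lt (by positivity)]
    have e1 : (3:ℝ)^((1:ℝ)/2) ≤ (3:ℝ)^((j:ℝ)/2 + η*j) :=
        Real.rpow_le_rpow_of_exponent_le (by norm_num) (by nlinarith)
    have e2 : (1.7:ℝ) ≤ (3:ℝ)^((1:ℝ)/2) := by
      rw [← Real.sqrt_eq_rpow]; exact Real.le_sqrt_of_sq_le (by norm_num)
    have e3 := Real.exp_one_lt_d9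
    have e4 : (2:ℝ) * 1.7 ≤ M := by
      rw [hM]; gcongr
      · linarith
      · linarith
    linarith
  have hmaps : ∀ n ∈ G, (oddCount j n, T^[j] n) ∈ (range (j+1)) ×ˢ fastSet g M := by
    intro n hn
    obtain ⟨r, r0, r1, hr⟩ := haff n hn
    simp only [hG, Finset.mem_filter] at hn
    obtain ⟨hlt, k, hk, hk1⟩ := hS n hn.1
    rw [Finset.mem_product]
    refine ⟨by simpa [Nat.lt_succ_iff] using oddCount_le j n, ?_⟩
    rw [mem_fastSet hM0]
    constructor
    · have e1 : (3:ℝ)^(oddCount j n) ≤ (3:ℝ)^((j:ℝ)/2 + η*j) := by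
        rw [← Real.rpow_natCast]
        exact Real.rpow_le_rpow_of_exponent_le (by norm_num) hn.2.2
      have e2 : (n:ℝ) + r ≤ (j+1) * 2^j := by
        have n1 : (n:ℝ) ≤ 2^j := by exact_mod_cast hlt.le
        have b1 : b ≤ 2^j := by
          rw [hb]
          have : (3:ℝ)^(η*j - (j:ℝ)/2) ≤ 1 :=
            Real.rpow_le_one_of_one_le_of_nonpos (by norm_num) (by nlinarith)
          have h2 : (0:ℝ) < 2^j := by positivity
          nlinarith
        have : j * b ≤ j * 2^j := by gcongr
        linarith
      have e3 : (2:ℝ)^j * (T^[j] n : ℕ) ≤ 2^j * M := by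
        rw [hr]
        calc (3:ℝ)^(oddCount j n) * (n + r) ≤ (3:ℝ)^((j:ℝ)/2 + η*j) * ((j+1) * 2^j) := by gcongr
          _ = _ := by rw [hM]; ring
      exact le_of_mul_le_mul_left e3 (by positivity)
    · rcases le_or_gt j k with hjk | hjk
      · refine ⟨k - j, ?_, ?_⟩
        · rw [Nat.cast_sub hjk]
          have : g2 * (j * Real.log 2) ≤ j * (1 + g * (Real.log 3/2)) := by
            have := mul_le_mul_of_nonneg_left hg2 (by linarith : (0:ℝ) ≤ j)
            linarith
          have h4 : g * (j * (Real.log 3/2)) ≤ g * Real.log M :=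
            mul_le_mul_of_nonneg_left hlogM (by linarith)
          linarith
        · rw [← Function.iterate_add_apply, Nat.sub_add_cancel hjk, hk1]
      · have hjn : T^[j] n = T^[j-k] 1 := by
          rw [← hk1, ← Function.iterate_add_apply, Nat.sub_add_cancel hjk.le]
        rw [hjn]
        rcases iterate_one (j-k) with h | h <;> rw [h]
        · exact ⟨0, by push_cast; nlinarith, rfl⟩
        · exact ⟨1, by push_cast; nlinarith, by simp [T]⟩
  have hGc : G.card ≤ (⌊j*b⌋₊ + 1) * ((range (j+1)) ×ˢ fastSet g M).card := by
    apply Finset.card_le_mul_card_image_of_maps_to hmaps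
    rintro ⟨i, m⟩ _
    apply card_window
    intro x hx y hy
    simp only [Finset.mem_filter, Prod.mk.injEq] at hx hy
    obtain ⟨r, r0, r1, hr⟩ := haff x hx.1
    obtain ⟨q, q0, q1, hq⟩ := haff y hy.1
    rw [hx.2.1, hx.2.2] at hr
    rw [hy.2.1, hy.2.2] at hq
    rw [hr] at hq
    have := mul_left_cancel₀ (by positivity) hq
    linarith
  have hGc' : (G.card : ℝ) ≤ (j*b + 1) * ((j+1) * (fastSet g M).card) := by
    have e : (G.card : ℝ) ≤ ((⌊j*b⌋₊:ℝ) + 1) * ((j+1) * (fastSet g M).card) := by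
      have := hGc
      rw [Finset.card_product, Finset.card_range] at this
      exact_mod_cast this
    refine e.trans ?_
    gcongr
    exact Nat.floor_le (by positivity)
  have hU : (((range (j+1)).biUnion Lo).card : ℝ) ≤ (j+1) * (2^j * Real.exp (-(2*η^2*j))) := by
    calc (((range (j+1)).biUnion Lo).card : ℝ) ≤ ((∑ t ∈ range (j+1), (Lo t).card : ℕ) : ℝ) := by
          exact_mod_cast Finset.card_biUnion_le
      _ = ∑ t ∈ range (j+1), ((Lo t).card : ℝ) := by push_cast; rfl
      _ ≤ ∑ t ∈ range (j+1), (2^j * Real.exp (-(2*η^2*j))) := Finset.sum_le_sum hLoc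
      _ = _ := by simp
  have hfin : (S.card : ℝ) ≤ ((range (j+1)).biUnion Lo).card + Hi.card + G.card := by
    have a1 := Finset.card_le_card hcover
    have a2 := Finset.card_union_le ((range (j+1)).biUnion Lo ∪ Hi) G
    have a3 := Finset.card_union_le ((range (j+1)).biUnion Lo) Hi
    have : S.card ≤ ((range (j+1)).biUnion Lo).card + Hi.card + G.card := by omega
    exact_mod_cast this
  linarith

/-- All but a power-saving set of integers are slow. -/
def FewFast (g : ℝ) : Prop := ∃ ε C : ℝ, 0 < ε ∧ ε < 1 ∧ 0 ≤ C ∧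
  ∀ X : ℝ, 1 ≤ X → ((fastSet g X).card : ℝ) ≤ C * X^(1-ε)

lemma fewFast_mono {g g' : ℝ} (h : g' ≤ g) (H : FewFast g) : FewFast g' := by
  obtain ⟨ε, C, h0, h1, hC, hb⟩ := H
  refine ⟨ε, C, h0, h1, hC, fun X hX => le_trans ?_ (hb X hX)⟩
  norm_cast
  apply Finset.card_le_card
  intro m hm
  rw [mem_fastSet (by linarith)] at hm ⊢
  obtain ⟨a, k, hk, hk1⟩ := hm
  refine ⟨a, k, hk.trans_le ?_, hk1⟩
  exact mul_le_mul_of_nonneg_right h (Real.log_nonneg hX)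

lemma fewFast_one : FewFast 1 := by
  refine ⟨1 - Real.log 2, 2, ?_, ?_, by norm_num, ?_⟩
  · linarith [Real.log_two_lt_d9]
  · linarith [Real.log_two_gt_d9]
  · intro X hX
    have hX0 : 0 < X := by linarith
    rw [sub_sub_cancel]
    have h1 : fastSet 1 X ⊆ range (⌊X^(Real.log 2)⌋₊ + 1) := by
      intro m hm
      rw [mem_fastSet hX0.le] at hm
      obtain ⟨_, k, hk, hk1⟩ := hm
      rw [Finset.mem_range, Nat.lt_succ_iff]
      apply Nat.le_floor
      have h2 : (m:ℝ) ≤ 2^k := by exact_mod_cast le_two_pow k m hk1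
      refine h2.trans ?_
      rw [← Real.rpow_natCast, Real.rpow_def_of_pos (by norm_num), Real.rpow_def_of_pos hX0]
      apply Real.exp_le_exp.2
      nlinarith [Real.log_two_gt_d9]
    have h2 := Finset.card_le_card h1
    rw [Finset.card_range] at h2
    have h3 : ((fastSet 1 X).card : ℝ) ≤ ⌊X^(Real.log 2)⌋₊ + 1 := by exact_mod_cast h2
    have h4 := Nat.floor_le (Real.rpow_nonneg hX0.le (Real.log 2))
    have h5 : 1 ≤ X^(Real.log 2) := Real.one_le_rpow hX (Real.log_nonneg (by norm_num))
    linarith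

set_option maxHeartbeats 1000000 in
lemma fewFast_step {g g2 : ℝ} (hg : 1 ≤ g) (hg0 : 0 ≤ g2)
    (hg2 : g2 * Real.log 2 ≤ 1 + g * (Real.log 3 / 2)) (H : FewFast g) : FewFast g2 := by
  obtain ⟨ε, C, h0, h1, hC, hbd⟩ := H
  have hl2 := Real.log_two_gt_d9
  set η : ℝ := ε/8 with hη
  set c : ℝ := 2*η^2 with hc
  have hc0 : 0 < c := by positivity
  have hc1 : c ≤ ε/4 := by rw [hc, hη]; nlinarith
  set D : ℝ := 6 * (2/c)^3 * Real.exp (c/2) with hD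
  have hD0 : 0 ≤ D := by positivity
  set ε' : ℝ := c / (2*Real.log 2) with hε'
  have he0 : 0 < ε' := by positivity
  have he1 : ε' < 1 := by
    rw [hε', div_lt_one (by positivity)]; linarith
  refine ⟨ε', 2 * ((2+C) * D), he0, he1, by positivity, ?_⟩
  intro X hX
  obtain ⟨i, hi1, hi2⟩ := exists_nat_pow_near hX (by norm_num : (1:ℝ) < 2)
  set j : ℕ := i + 1 with hj
  have hlog : Real.log X ≤ j * Real.log 2 := by
    have := Real.log_le_log (by linarith) hi2.le
    rwa [Real.log_pow] at this
  have hcount := count_step g g2 hg hg2 j (by omega) η (by positivity) (by linarith) (fastSet g2 X) (by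
    intro n hn
    rw [mem_fastSet (by linarith)] at hn
    obtain ⟨a, k, hk, hk1⟩ := hn
    refine ⟨by exact_mod_cast a.trans_lt hi2, k, hk.trans_le ?_, hk1⟩
    exact mul_le_mul_of_nonneg_left hlog hg0)
  set J : ℝ := (j:ℝ) with hJ
  have hJ1 : 1 ≤ J := by rw [hJ]; exact_mod_cast (by omega : 1 ≤ j)
  set M : ℝ := (J+1) * (3:ℝ)^(J/2 + η*J) with hM
  set b : ℝ := 2^j * (3:ℝ)^(η*J - J/2) with hb
  have hη0 : 0 < η := by positivity
  have hM1 : 1 ≤ M := by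
    have : 1 ≤ (3:ℝ)^(J/2 + η*J) := Real.one_le_rpow (by norm_num) (by positivity)
    rw [hM]; nlinarith
  have hb1 : 1 ≤ b := by
    have := typical_pow j 0 (by omega) (η*J) 0 (by push_cast; nlinarith)
    simpa using this
  have hF := hbd M hM1
  have hMp : M^(1-ε) ≤ (J+1) * (3:ℝ)^((J/2+η*J)*(1-ε)) := by
    rw [hM, Real.mul_rpow (by positivity) (by positivity), ← Real.rpow_mul (by norm_num)]
    gcongr
    calc (J+1)^(1-ε) ≤ (J+1)^(1:ℝ) := Real.rpow_le_rpow_of_exponent_le (by linarith) (by linarith)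
      _ = J+1 := Real.rpow_one _
  have h3 : (3:ℝ)^(η*J - J/2) * (3:ℝ)^((J/2+η*J)*(1-ε)) ≤ Real.exp (-(c*J)) := by
    rw [← Real.rpow_add (by norm_num), Real.rpow_def_of_pos (by norm_num)]
    apply Real.exp_le_exp.2
    have l3 : 1 ≤ Real.log 3 := by
      rw [Real.le_log_iff_exp_le (by norm_num)]
      linarith [Real.exp_one_lt_d9]
    have e1 : η*J - J/2 + (J/2+η*J)*(1-ε) ≤ -(ε/4*J) := by
      have : 0 ≤ η*J*ε := by positivity
      rw [hη] at this ⊢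
      nlinarith
    have e2 : c*J ≤ ε/4*J := by gcongr
    have e3 : 0 ≤ ε/4*J := by positivity
    nlinarith
  have ht2 : (J*b+1) * ((J+1) * (fastSet g M).card) ≤ C * ((J+1)^3 * (2^j * Real.exp (-(c*J)))) := by
    calc (J*b+1) * ((J+1) * ((fastSet g M).card:ℝ))
        ≤ ((J+1)*b) * ((J+1) * (C * ((J+1) * (3:ℝ)^((J/2+η*J)*(1-ε))))) := by
          gcongr
          · linarith
          · exact hF.trans (by gcongr)
      _ = C * ((J+1)^3 * (2^j * ((3:ℝ)^(η*J - J/2) * (3:ℝ)^((J/2+η*J)*(1-ε))))) := by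
          rw [hb]; ring
      _ ≤ _ := by gcongr
  have ht1 : (J+2) * (2^j * Real.exp (-(2*η^2*J))) ≤ 2 * ((J+1)^3 * (2^j * Real.exp (-(c*J)))) := by
    rw [← mul_assoc 2]
    gcongr
    nlinarith [sq_nonneg J]
  have hpoly : (J+1)^3 ≤ D * Real.exp (c*J/2) := by
    have := Real.pow_div_factorial_le_exp (c*(J+1)/2) (by positivity) 3
    have e : Real.exp (c*(J+1)/2) = Real.exp (c/2) * Real.exp (c*J/2) := by
      rw [← Real.exp_add]; congr 1; ring
    rw [e] at this
    have h6 : ((Nat.factorial 3 : ℕ):ℝ) = 6 := by norm_num [Nat.factorial]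
    rw [h6] at this
    calc (J+1)^3 = 6 * (2/c)^3 * ((c*(J+1)/2)^3/6) := by field_simp
      _ ≤ 6 * (2/c)^3 * (Real.exp (c/2) * Real.exp (c*J/2)) := by gcongr
      _ = _ := by rw [hD]; ring
  have hX2 : 2^j * Real.exp (-(c*J/2)) ≤ 2 * X^(1-ε') := by
    have e1 : (2:ℝ)^j * Real.exp (-(c*J/2)) = ((2:ℝ)^j)^(1-ε') := by
      rw [Real.rpow_def_of_pos (by positivity), Real.log_pow]
      have : (2:ℝ)^j = Real.exp (J * Real.log 2) := by
        rw [hJ, Real.exp_nat_mul, Real.exp_log (by norm_num)]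
      rw [this, ← Real.exp_add]
      congr 1
      rw [hε']; field_simp; ring
    rw [e1]
    calc ((2:ℝ)^j)^(1-ε') ≤ (2*X)^(1-ε') := by
          apply Real.rpow_le_rpow (by positivity) _ (by linarith)
          rw [hj, pow_succ]; linarith
      _ = 2^(1-ε') * X^(1-ε') := Real.mul_rpow (by norm_num) (by linarith)
      _ ≤ 2 * X^(1-ε') := by
          have : (2:ℝ)^(1-ε') ≤ 2^(1:ℝ) := Real.rpow_le_rpow_of_exponent_le (by norm_num) (by linarith)
          rw [Real.rpow_one] at this
          have : 0 ≤ X^(1-ε') := Real.rpow_nonneg (by linarith) _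
          gcongr
  have hexp : Real.exp (c*J/2) * Real.exp (-(c*J)) = Real.exp (-(c*J/2)) := by
    rw [← Real.exp_add]; congr 1; ring
  calc ((fastSet g2 X).card : ℝ) ≤ (2+C) * ((J+1)^3 * (2^j * Real.exp (-(c*J)))) := by linarith
    _ ≤ (2+C) * ((D * Real.exp (c*J/2)) * (2^j * Real.exp (-(c*J)))) := by gcongr
    _ = (2+C) * D * (2^j * (Real.exp (c*J/2) * Real.exp (-(c*J)))) := by ring
    _ ≤ (2+C) * D * (2 * X^(1-ε')) := by rw [hexp]; gcongr
    _ = _ := by ring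

lemma fewFast_num {g : ℝ} (g2 : ℝ) (hg : 1 ≤ g) (h0 : 0 ≤ g2) (h : g2 ≤ 1.4426 + 0.792 * g)
    (H : FewFast g) : FewFast g2 := by
  refine fewFast_step hg h0 ?_ H
  have l2 := Real.log_two_lt_d9
  have l2' := Real.log_two_gt_d9
  have l3 : 198 * Real.log 2 ≤ 125 * Real.log 3 := by
    have := Real.log_le_log (by norm_num) (by norm_num : (2:ℝ)^198 ≤ 3^125)
    rw [Real.log_pow, Real.log_pow] at this
    exact_mod_cast this
  have e1 : g2 * Real.log 2 ≤ (1.4426 + 0.792 * g) * Real.log 2 := by gcongr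
  have e2 : g * (0.792 * Real.log 2) ≤ g * (Real.log 3 / 2) := by
    apply mul_le_mul_of_nonneg_left _ (by linarith); linarith
  nlinarith

lemma fewFast_main : FewFast 6.143 := by
  have h1 := fewFast_num 2.234 (by norm_num) (by norm_num) (by norm_num) fewFast_one
  have h2 := fewFast_num 3.211 (by norm_num) (by norm_num) (by norm_num) h1
  have h3 := fewFast_num 3.985 (by norm_num) (by norm_num) (by norm_num) h2
  have h4 := fewFast_num 4.598 (by norm_num) (by norm_num) (by norm_num) h3
  have h5 := fewFast_num 5.084 (by norm_num) (by norm_num) (by norm_num) h4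
  have h6 := fewFast_num 5.469 (by norm_num) (by norm_num) (by norm_num) h5
  have h7 := fewFast_num 5.774 (by norm_num) (by norm_num) (by norm_num) h6
  have h8 := fewFast_num 6.015 (by norm_num) (by norm_num) (by norm_num) h7
  exact fewFast_num 6.143 (by norm_num) (by norm_num) (by norm_num) h8

/-- (Applegate–Lagarias) There are infinitely many positive integers `n` that take
at least `6.143·log n` steps to reach 1 under iteration of the 3x+1 function. -/
theorem infinitely_many_slow_integers :
    {n : ℕ | 0 < n ∧ ∀ k : ℕ, T^[k] n = 1 → (6.143 : ℝ) * Real.log n ≤ k}.Infinite := by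
  intro hfin
  obtain ⟨N, hN⟩ := hfin.bddAbove
  obtain ⟨ε, C, h0, h1, hC, hbd⟩ := fewFast_main
  have hfast : ∀ n : ℕ, N < n → ∃ k : ℕ, (k:ℝ) < 6.143 * Real.log n ∧ T^[k] n = 1 := by
    intro n hn
    by_contra hcon
    push Not at hcon
    have : n ≤ N := hN ⟨by omega, fun k hk => by
      by_contra h
      exact hcon k (not_le.1 h) hk⟩
    omega
  have hlow : ∀ Y : ℕ, 1 ≤ Y → (Y:ℝ) - N ≤ C * (Y:ℝ)^(1-ε) := by
    intro Y hY
    have hY1 : (1:ℝ) ≤ Y := by exact_mod_cast hY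
    refine le_trans ?_ (hbd Y hY1)
    have hsub : Finset.Ioc N Y ⊆ fastSet 6.143 Y := by
      intro n hn
      rw [Finset.mem_Ioc] at hn
      rw [mem_fastSet (by linarith)]
      obtain ⟨k, hk, hk1⟩ := hfast n hn.1
      refine ⟨by exact_mod_cast hn.2, k, hk.trans_le ?_, hk1⟩
      have : Real.log n ≤ Real.log Y :=
        Real.log_le_log (by exact_mod_cast (by omega : 0 < n)) (by exact_mod_cast hn.2)
      linarith
    have h2 := Finset.card_le_card hsub
    rw [Nat.card_Ioc] at h2
    have h3 : Y ≤ (fastSet 6.143 Y).card + N := by omega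
    have h4 : (Y:ℝ) ≤ (fastSet 6.143 Y).card + N := by exact_mod_cast h3
    linarith
  have hlim : Filter.Tendsto (fun Y : ℕ => (Y:ℝ)^ε) Filter.atTop Filter.atTop :=
    (tendsto_rpow_atTop h0).comp tendsto_natCast_atTop_atTop
  obtain ⟨Y, hY1, hY2, hY3⟩ := ((hlim.eventually_gt_atTop (2*C)).and
    ((Filter.eventually_gt_atTop (2*N)).and (Filter.eventually_ge_atTop 1))).exists
  have hYp : (0:ℝ) < Y := by exact_mod_cast hY3
  have h5 := hlow Y hY3
  have h6 : (Y:ℝ)^(1-ε) * (Y:ℝ)^ε = Y := by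
    rw [← Real.rpow_add hYp]; simp
  have h7 : (0:ℝ) < (Y:ℝ)^(1-ε) := Real.rpow_pos_of_pos hYp _
  have h8 : (2*N:ℝ) < Y := by exact_mod_cast hY2
  nlinarith
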